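/- Let T be a tree with m edges. There exists a positive integer N such that for every n ≥ N there is an integer z < n²/2 with the property that every 2-edge coloring E(K_{n,n}) = R ⊔ B with more than z edges in each color class contains a balanced copy of T, i.e., a copy of T whose edge set splits as E₁ ⊔ E₂ with E₁ ⊆ R, E₂ ⊆ B and ||E₁| − |E₂|| ≤ 1. In other words, every tree is bipartite balanceable. -/

import Mathlib

/-- The number of red edges in a 2-edge coloring of `K_{n,n}`.  The coloring is encoded
as `c : Fin n → Fin n → Bool`, where `c v w = true` means that the edge between vertex `v`
of the first part and vertex `w` of the second part is red, and `c v w = false` means it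
is blue. -/
def redTotal {n : ℕ} (c : Fin n → Fin n → Bool) : ℕ :=
  (Finset.univ.filter fun p : Fin n × Fin n => c p.1 p.2 = true).card

/-- The number of blue edges in a 2-edge coloring of `K_{n,n}`. -/
def blueTotal {n : ℕ} (c : Fin n → Fin n → Bool) : ℕ :=
  (Finset.univ.filter fun p : Fin n × Fin n => c p.1 p.2 = false).card

/-- `redB c u v = true` iff `u` and `v` lie in different parts of `K_{n,n}` and the edge
between them is red (under the coloring `c : Fin n → Fin n → Bool`, where `c v w = true`
means the edge between vertex `v` of the first part and `w` of the second part is red). -/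
def redB {n : ℕ} (c : Fin n → Fin n → Bool) : Fin n ⊕ Fin n → Fin n ⊕ Fin n → Bool
  | Sum.inl v, Sum.inr w => c v w
  | Sum.inr w, Sum.inl v => c v w
  | _, _ => false

/-- `blueB c u v = true` iff `u` and `v` lie in different parts of `K_{n,n}` and the edge
between them is blue. -/
def blueB {n : ℕ} (c : Fin n → Fin n → Bool) : Fin n ⊕ Fin n → Fin n ⊕ Fin n → Bool
  | Sum.inl v, Sum.inr w => !c v w
  | Sum.inr w, Sum.inl v => !c v w
  | _, _ => false

/-- `crossB u v = true` iff `u` and `v` lie in different parts of `K_{n,n}`,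
i.e. `u v` is an edge of `K_{n,n}`. -/
def crossB {n : ℕ} : Fin n ⊕ Fin n → Fin n ⊕ Fin n → Bool
  | Sum.inl _, Sum.inr _ => true
  | Sum.inr _, Sum.inl _ => true
  | _, _ => false

/-- `redSym c` decides whether an edge of `K_{n,n}` (as an unordered pair of vertices in
`Fin n ⊕ Fin n`) joins the two parts and is colored red by `c`. -/
def redSym {n : ℕ} (c : Fin n → Fin n → Bool) : Sym2 (Fin n ⊕ Fin n) → Bool :=
  Sym2.lift ⟨redB c, by rintro (x | x) (y | y) <;> rfl⟩

/-- `blueSym c` decides whether an edge of `K_{n,n}` (as an unordered pair of vertices in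
`Fin n ⊕ Fin n`) joins the two parts and is colored blue by `c`. -/
def blueSym {n : ℕ} (c : Fin n → Fin n → Bool) : Sym2 (Fin n ⊕ Fin n) → Bool :=
  Sym2.lift ⟨blueB c, by rintro (x | x) (y | y) <;> rfl⟩

/-- `IsGraphCopy G f` says that `f` realizes a copy of the graph `G` in `K_{n,n}`
(a subgraph of `K_{n,n}` isomorphic to `G`): `f` is injective and maps every edge of `G`
to an edge of `K_{n,n}` (a pair of vertices in different parts). -/
def IsGraphCopy {n : ℕ} {γ : Type*} (G : SimpleGraph γ) (f : γ → Fin n ⊕ Fin n) : Prop :=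
  Function.Injective f ∧ ∀ a b, G.Adj a b → crossB (f a) (f b) = true

/-- The number of red edges of the copy of `G` realized by `f` in `K_{n,n}` colored
by `c`. -/
noncomputable def graphRedCount {n : ℕ} {γ : Type*} (c : Fin n → Fin n → Bool) (G : SimpleGraph γ)
    (f : γ → Fin n ⊕ Fin n) : ℕ :=
  {e ∈ G.edgeSet | redSym c (Sym2.map f e) = true}.ncard

/-- The number of blue edges of the copy of `G` realized by `f` in `K_{n,n}` colored
by `c`. -/
noncomputable def graphBlueCount {n : ℕ} {γ : Type*} (c : Fin n → Fin n → Bool) (G : SimpleGraph γ)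
    (f : γ → Fin n ⊕ Fin n) : ℕ :=
  {e ∈ G.edgeSet | blueSym c (Sym2.map f e) = true}.ncard

open Finset in
/-- Positive integers `d i`, `i ∈ s`, whose sum is less than `2 * #s` realize every value up to
their total as a subset sum. -/
theorem exists_subset_sum_eq_of_sum_lt_two_mul_card {ι : Type*} (d : ι → ℕ) (s : Finset ι) (t : ℕ)
    (hpos : ∀ i ∈ s, 1 ≤ d i) (hsum : ∑ i ∈ s, d i < 2 * #s) (ht : t ≤ ∑ i ∈ s, d i) :
    ∃ u ⊆ s, ∑ i ∈ u, d i = t := by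
  classical
  induction s using Finset.strongInduction generalizing t with
  | H s ih =>
    by_cases hone : ∀ i ∈ s, d i = 1
    · rw [sum_congr rfl hone, sum_const, smul_eq_mul, mul_one] at ht
      obtain ⟨u, hu, rfl⟩ := exists_subset_card_eq ht
      exact ⟨u, hu, by rw [sum_congr rfl fun i hi => hone i (hu hi)]; simp⟩
    · push Not at hone
      obtain ⟨a, ha, hda⟩ := hone
      have hda1 := hpos a ha
      have hadd := add_sum_erase s d ha
      have hcard := card_erase_add_one ha
      have hge : #(s.erase a) ≤ ∑ i ∈ s.erase a, d i := by
        simpa using card_nsmul_le_sum (s.erase a) d 1 fun i hi => hpos i (mem_of_mem_erase hi)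
      have key := ih (s.erase a) (erase_ssubset ha) (hpos := fun i hi => hpos i (mem_of_mem_erase hi))
        (hsum := by omega)
      by_cases hle : t ≤ ∑ i ∈ s.erase a, d i
      · obtain ⟨u, hu, hut⟩ := key t hle
        exact ⟨u, hu.trans (erase_subset a s), hut⟩
      · obtain ⟨u, hu, hut⟩ := key (t - d a) (by omega)
        refine ⟨insert a u, insert_subset ha (hu.trans (erase_subset a s)), ?_⟩
        rw [sum_insert fun h => (mem_erase.1 (hu h)).1 rfl, hut]
        omega

open Finset in
/-- A bipartite relation in which every vertex of a large set `M` has linear degree contains a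
complete pair of sets of sizes `j` and `t`, the second inside `M`. -/
theorem exists_complete_pair_of_le_degree {α β : Type*} [Fintype β] (r : α → β → Prop)
    [∀ a b, Decidable (r a b)] (C j t : ℕ) (hC : 0 < C) (ht : 0 < t) (M : Finset α)
    (hdeg : ∀ a ∈ M, Fintype.card β + C * j ≤ C * #{b | r a b}) (hM : C ^ j * t ≤ #M) :
    ∃ S : Finset β, #S = j ∧ ∃ M' ⊆ M, t ≤ #M' ∧ ∀ a ∈ M', ∀ b ∈ S, r a b := by
  classical
  induction j generalizing t with
  | zero => exact ⟨∅, rfl, M, Subset.rfl, by simpa using hM, by simp⟩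
  | succ j ih =>
    obtain ⟨S, hS, M', hM', hcard, hr⟩ := ih (C * t) (by positivity)
      (fun a ha => by have := hdeg a ha; rw [mul_add] at this; omega)
      (by rwa [← mul_assoc, ← pow_succ])
    obtain ⟨b, hbS, hb⟩ : ∃ b ∈ Sᶜ, t ≤ #{a ∈ M' | r a b} := by
      by_contra! hlt
      have hswap : ∑ a ∈ M', #{b ∈ Sᶜ | r a b} = ∑ b ∈ Sᶜ, #{a ∈ M' | r a b} :=
        sum_card_bipartiteAbove_eq_sum_card_bipartiteBelow r
      have hupper : ∑ b ∈ Sᶜ, #{a ∈ M' | r a b} ≤ Fintype.card β * t := by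
        calc _ ≤ #Sᶜ * t := by
              simpa using sum_le_card_nsmul Sᶜ _ t fun b hb => (hlt b hb).le
          _ ≤ _ := Nat.mul_le_mul_right _ (card_le_univ _)
      have hlower : #M' * (Fintype.card β + C) ≤ C * ∑ a ∈ M', #{b ∈ Sᶜ | r a b} := by
        rw [mul_sum]
        refine card_nsmul_le_sum M' _ (Fintype.card β + C) fun a ha => ?_
        have hd := hdeg a (hM' ha)
        have hle : #{b | r a b} ≤ #{b ∈ Sᶜ | r a b} + j := by
          rw [← hS]
          refine (card_le_card fun b hb => ?_).trans (card_union_le _ _)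
          by_cases h : b ∈ S <;> simp_all
        nlinarith
      rw [hswap] at hlower
      have hpos : 0 < C * t := by positivity
      nlinarith [Nat.mul_le_mul_left C hupper, Nat.mul_le_mul_right (Fintype.card β) hcard,
        Nat.mul_pos (hpos.trans_le hcard) hC]
    refine ⟨insert b S, by rw [card_insert_of_notMem (by simpa using hbS), hS],
      {a ∈ M' | r a b}, (filter_subset _ _).trans hM', hb, fun a ha b' hb' => ?_⟩
    rw [mem_filter] at ha
    rcases mem_insert.1 hb' with rfl | hb'
    exacts [ha.2, hr a ha.1 b' hb']

/-- A 2-coloring of `K_{n,n}` has a `k`-split pattern if there are sets `P`, `Q` of `k` vertices in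
the first part and `S` of `k` vertices in the second part such that all edges between `P` and `S`
are red and all edges between `Q` and `S` are blue. -/
def HasSplitPattern {n : ℕ} (k : ℕ) (c : Fin n → Fin n → Bool) : Prop :=
  ∃ P Q S : Finset (Fin n), k ≤ P.card ∧ k ≤ Q.card ∧ k ≤ S.card ∧
    (∀ v ∈ P, ∀ w ∈ S, c v w = true) ∧ ∀ v ∈ Q, ∀ w ∈ S, c v w = false

/-- The number of edges of color `b` at a vertex `v` of the first part. -/
def colorDegree {n : ℕ} (c : Fin n → Fin n → Bool) (b : Bool) (v : Fin n) : ℕ :=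
  (Finset.univ.filter fun w => c v w = b).card

theorem colorDegree_le {n : ℕ} (c : Fin n → Fin n → Bool) (b : Bool) (v : Fin n) :
    colorDegree c b v ≤ n :=
  (Finset.card_le_univ _).trans_eq (Fintype.card_fin n)

theorem card_filter_eq_sum_colorDegree {n : ℕ} (c : Fin n → Fin n → Bool) (b : Bool) :
    (Finset.univ.filter fun p : Fin n × Fin n => c p.1 p.2 = b).card = ∑ v, colorDegree c b v := by
  simp only [colorDegree, Finset.card_filter, Fintype.sum_prod_type]

open Finset in
/-- If `n` vertices have total degree more than `n ^ 2 / 4` in color `b`, and few of them are almost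
entirely of color `b`, then many have linear degree in both colors. -/
theorem card_mixed_ge {n k : ℕ} (c : Fin n → Fin n → Bool) (b : Bool) (hk : 0 < k)
    (hn : 16 * k * k ≤ n) (hb : n ^ 2 < 4 * ∑ v, colorDegree c b v)
    (hfew : #{v | 16 * k * colorDegree c (!b) v < n + 16 * k * k} < k) :
    n ≤ 8 * (k + #{v | n + 16 * k * k ≤ 16 * k * colorDegree c b v ∧
      n + 16 * k * k ≤ 16 * k * colorDegree c (!b) v}) := by
  set A : Finset (Fin n) := {v | 16 * k * colorDegree c (!b) v < n + 16 * k * k}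
  set M : Finset (Fin n) := {v | n + 16 * k * k ≤ 16 * k * colorDegree c b v ∧
      n + 16 * k * k ≤ 16 * k * colorDegree c (!b) v}
  have hpoint : ∀ v, 16 * k * colorDegree c b v ≤
      2 * n + (if v ∈ A then 16 * k * n else 0) + (if v ∈ M then 16 * k * n else 0) := by
    intro v
    have hle := Nat.mul_le_mul_left (16 * k) (colorDegree_le c b v)
    by_cases hA : v ∈ A
    · rw [if_pos hA]; omega
    by_cases hM : v ∈ M
    · rw [if_pos hM]; omega
    · simp only [A, M, mem_filter, mem_univ, true_and, not_and, not_le, not_lt] at hA hM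
      have : ¬ n + 16 * k * k ≤ 16 * k * colorDegree c b v := fun h => by have := hM h; omega
      omega
  have hsum := sum_le_sum fun v (_ : v ∈ (univ : Finset (Fin n))) => hpoint v
  simp only [← mul_sum, sum_add_distrib, sum_ite_mem, univ_inter, sum_const, card_univ,
    Fintype.card_fin, smul_eq_mul] at hsum
  have hn0 : 0 < n := lt_of_lt_of_le (by positivity) hn
  by_contra! hlt
  have h1 : 16 * k * n ^ 2 < 4 * (n * (2 * n) + #A * (16 * k * n) + #M * (16 * k * n)) := by
    nlinarith
  have h2 : n * (16 * k * n) < n * (8 * n + 64 * k * (#A + #M)) := by nlinarith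
  have h3 := Nat.lt_of_mul_lt_mul_left h2
  nlinarith [Nat.mul_le_mul_left n hk]

theorem HasSplitPattern.of_color {n k : ℕ} {c : Fin n → Fin n → Bool} (b : Bool)
    {P Q S : Finset (Fin n)} (hP : k ≤ P.card) (hQ : k ≤ Q.card) (hS : k ≤ S.card)
    (hPS : ∀ v ∈ P, ∀ w ∈ S, c v w = b) (hQS : ∀ v ∈ Q, ∀ w ∈ S, c v w = !b) :
    HasSplitPattern k c := by
  cases b
  exacts [⟨Q, P, S, hQ, hP, hS, hQS, hPS⟩, ⟨P, Q, S, hP, hQ, hS, hPS, hQS⟩]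

open Finset in
/-- Many vertices of linear degree in both colors yield a split pattern with the second part
split. -/
theorem hasSplitPattern_of_card_mixed {n k : ℕ} (c : Fin n → Fin n → Bool) (b : Bool) (hk : 0 < k)
    (hM : (16 * k) ^ k * ((16 * k) ^ k * k) ≤ #{v | n + 16 * k * k ≤ 16 * k * colorDegree c b v ∧
      n + 16 * k * k ≤ 16 * k * colorDegree c (!b) v}) :
    HasSplitPattern k fun w v => c v w := by
  obtain ⟨P, hP, M₁, hM₁, hcard₁, hr₁⟩ := exists_complete_pair_of_le_degree
    (fun v w => c v w = b) (16 * k) k _ (by positivity) (by positivity) _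
    (fun v hv => by simpa [colorDegree] using (mem_filter.1 hv).2.1) hM
  obtain ⟨Q, hQ, M₂, hM₂, hcard₂, hr₂⟩ := exists_complete_pair_of_le_degree
    (fun v w => c v w = !b) (16 * k) k _ (by positivity) hk M₁
    (fun v hv => by simpa [colorDegree] using (mem_filter.1 (hM₁ hv)).2.2) hcard₁
  exact .of_color b hP.ge hQ.ge hcard₂ (fun w hw v hv => hr₁ v (hM₂ hv) w hw)
    fun w hw v hv => hr₂ v hv w hw

open Finset in
/-- If `k` vertices are almost entirely red and `k` vertices are almost entirely blue, there is a
split pattern with the first part split. -/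
theorem hasSplitPattern_of_card_almost_monochromatic {n k : ℕ} (c : Fin n → Fin n → Bool)
    (hn : 16 * k * k ≤ n) (hk : 0 < k)
    (hred : k ≤ #{v | 16 * k * colorDegree c false v < n + 16 * k * k})
    (hblue : k ≤ #{v | 16 * k * colorDegree c true v < n + 16 * k * k}) :
    HasSplitPattern k c := by
  obtain ⟨P, hP, hPk⟩ := exists_subset_card_eq hred
  obtain ⟨Q, hQ, hQk⟩ := exists_subset_card_eq hblue
  have hbad : ∀ (b : Bool) (U : Finset (Fin n)),
      U ⊆ ({v | 16 * k * colorDegree c b v < n + 16 * k * k} : Finset (Fin n)) → #U = k →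
      8 * #(U.biUnion fun v => {w | c v w = b}) ≤ n := by
    intro b U hU hUk
    have hle : 16 * k * #(U.biUnion fun v => {w | c v w = b}) ≤ k * (2 * n) := by
      calc _ ≤ 16 * k * ∑ v ∈ U, colorDegree c b v := Nat.mul_le_mul_left _ card_biUnion_le
        _ = ∑ v ∈ U, 16 * k * colorDegree c b v := mul_sum ..
        _ ≤ #U • (2 * n) := sum_le_card_nsmul _ _ _ fun v hv => by
            have := (mem_filter.1 (hU hv)).2
            omega
        _ = _ := by rw [hUk, smul_eq_mul]
    have : k * (16 * #(U.biUnion fun v => {w | c v w = b})) ≤ k * (2 * n) := by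
      rwa [← mul_assoc, mul_comm k 16]
    have := Nat.le_of_mul_le_mul_left this hk
    omega
  have hPbad := hbad false P hP hPk
  have hQbad := hbad true Q hQ hQk
  set X := P.biUnion fun v => ({w | c v w = false} : Finset (Fin n)) with hX
  set Y := Q.biUnion fun v => ({w | c v w = true} : Finset (Fin n)) with hY
  refine ⟨P, Q, (X ∪ Y)ᶜ, hPk.ge, hQk.ge, ?_, fun v hv w hw => ?_, fun v hv w hw => ?_⟩
  · have := card_union_le X Y
    rw [card_compl, Fintype.card_fin]
    have : 2 * k ≤ n := by nlinarith
    omega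
  · by_contra h
    refine mem_compl.1 hw (mem_union_left _ (mem_biUnion.2 ⟨v, hv, ?_⟩))
    simpa using h
  · by_contra h
    refine mem_compl.1 hw (mem_union_right _ (mem_biUnion.2 ⟨v, hv, ?_⟩))
    simpa using h

/-- For large `n`, every 2-coloring of `K_{n,n}` with more than a quarter of the edges in each
color contains a split pattern, up to swapping the two parts. -/
theorem hasSplitPattern_or_of_quarter {n k : ℕ} (hk : 0 < k)
    (hn : 16 * k * k + 8 * (k + (16 * k) ^ k * ((16 * k) ^ k * k)) ≤ n)
    (c : Fin n → Fin n → Bool) (hred : n ^ 2 < 4 * redTotal c) (hblue : n ^ 2 < 4 * blueTotal c) :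
    HasSplitPattern k c ∨ HasSplitPattern k fun w v => c v w := by
  rw [redTotal, card_filter_eq_sum_colorDegree] at hred
  rw [blueTotal, card_filter_eq_sum_colorDegree] at hblue
  have hn' : 16 * k * k ≤ n := by omega
  by_cases h₁ : k ≤ (Finset.univ.filter
      fun v => 16 * k * colorDegree c false v < n + 16 * k * k).card
  · by_cases h₂ : k ≤ (Finset.univ.filter
        fun v => 16 * k * colorDegree c true v < n + 16 * k * k).card
    · exact .inl (hasSplitPattern_of_card_almost_monochromatic c hn' hk h₁ h₂)
    · refine .inr (hasSplitPattern_of_card_mixed c false hk ?_)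
      have := card_mixed_ge c false hk hn' hblue (not_le.1 h₂)
      omega
  · refine .inr (hasSplitPattern_of_card_mixed c true hk ?_)
    have := card_mixed_ge c true hk hn' hred (not_le.1 h₁)
    omega

/-- In a tree some color class `Y` of a proper 2-coloring contains a subset whose
degrees sum to half the number of edges, rounded down. -/
theorem SimpleGraph.IsTree.exists_isBipartiteWith_sum_degree_eq_half {γ : Type*} [Fintype γ]
    {T : SimpleGraph γ} [DecidableRel T.Adj] (hT : T.IsTree) :
    ∃ X Y Z : Finset γ, T.IsBipartiteWith (X : Set γ) Y ∧ (∀ v, v ∉ Y → v ∈ X) ∧ Z ⊆ Y ∧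
      ∑ v ∈ Z, T.degree v = T.edgeFinset.card / 2 := by
  classical
  obtain ⟨col⟩ := hT.isAcyclic.colorable_two
  have hbip : ∀ i : Fin 2, T.IsBipartiteWith
      ((Finset.univ.filter fun v => col v ≠ i : Finset γ) : Set γ)
      (Finset.univ.filter fun v => col v = i : Finset γ) := by
    refine fun i => ⟨by simp [Set.disjoint_left], fun v w hvw => ?_⟩
    have := col.valid hvw
    simp only [Finset.coe_filter, Finset.mem_univ, true_and, Set.mem_ofPred_eq]
    omega
  obtain ⟨i, hi⟩ : ∃ i : Fin 2,
      Fintype.card γ ≤ 2 * (Finset.univ.filter fun v => col v = i).card := by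
    by_contra! h
    have h0 := h 0
    have h1 := h 1
    have hadd := Finset.card_filter_add_card_filter_not (s := Finset.univ) fun v => col v = 0
    have hcongr : (Finset.univ.filter fun v => ¬ col v = 0) =
        Finset.univ.filter fun v => col v = 1 := by
      ext v
      simp only [Finset.mem_filter, Finset.mem_univ, true_and]
      omega
    rw [hcongr, Finset.card_univ] at hadd
    omega
  have hsum := SimpleGraph.isBipartiteWith_sum_degrees_eq_card_edges' (hbip i)
  have hcard := hT.card_edgeFinset
  rcases subsingleton_or_nontrivial γ with hγ | hγ
  · have := Fintype.card_le_one_iff_subsingleton.2 hγ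
    refine ⟨_, _, ∅, hbip i, by simp, Finset.empty_subset _, ?_⟩
    rw [Finset.sum_empty]
    omega
  · obtain ⟨Z, hZ, hZsum⟩ := exists_subset_sum_eq_of_sum_lt_two_mul_card (fun v => T.degree v)
      (Finset.univ.filter fun v => col v = i) (T.edgeFinset.card / 2)
      (fun v _ => hT.connected.preconnected.degree_pos_of_nontrivial v) (by omega) (by omega)
    exact ⟨_, _, Z, hbip i, by simp, hZ, hZsum⟩

/-- The number of edges meeting an independent set is the sum of the degrees of its vertices. -/
theorem SimpleGraph.ncard_edges_meeting_independent {γ : Type*} [Fintype γ] (G : SimpleGraph γ)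
    [DecidableRel G.Adj] (Z : Finset γ) (hZ : G.IsIndepSet (Z : Set γ)) :
    {e ∈ G.edgeSet | ∃ v ∈ Z, v ∈ e}.ncard = ∑ v ∈ Z, G.degree v := by
  classical
  have heq : {e ∈ G.edgeSet | ∃ v ∈ Z, v ∈ e} = (Z.biUnion fun v => G.incidenceFinset v) := by
    ext e
    simp only [Set.mem_ofPred_eq, Finset.coe_biUnion, Finset.mem_coe, Set.mem_iUnion,
      SimpleGraph.mem_incidenceFinset, SimpleGraph.incidenceSet]
    grind
  rw [heq, Set.ncard_coe_finset, Finset.card_biUnion]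
  · simp
  · intro u hu v hv huv
    refine Finset.disjoint_left.2 fun e heu hev => ?_
    rw [SimpleGraph.mem_incidenceFinset] at heu hev
    obtain rfl := (Sym2.mem_and_mem_iff huv).1 ⟨heu.2, hev.2⟩
    exact hZ hu hv huv heu.1

theorem graphRedCount_add_graphBlueCount {n : ℕ} {γ : Type*} [Finite γ]
    (c : Fin n → Fin n → Bool) (G : SimpleGraph γ) {f : γ → Fin n ⊕ Fin n}
    (hf : IsGraphCopy G f) :
    graphRedCount c G f + graphBlueCount c G f = G.edgeSet.ncard := by
  rw [graphRedCount, graphBlueCount, ← Set.ncard_union_eq]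
  · congr 1
    ext e
    induction e with | _ a b =>
    have := hf.2 a b
    simp only [Set.mem_union, Set.mem_sep_iff, SimpleGraph.mem_edgeSet, redSym, blueSym,
      Sym2.map_mk, Sym2.lift_mk]
    generalize f a = x at this ⊢
    generalize f b = y at this ⊢
    rcases x with v | v <;> rcases y with w | w <;> simp_all [redB, blueB, crossB] <;> grind
  · rw [Set.disjoint_left]
    intro e
    induction e with | _ a b =>
    simp only [Set.mem_sep_iff, redSym, blueSym, Sym2.map_mk, Sym2.lift_mk]
    rcases f a with v | v <;> rcases f b with w | w <;> simp_all [redB, blueB]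

theorem IsGraphCopy.swap {n : ℕ} {γ : Type*} {G : SimpleGraph γ} {f : γ → Fin n ⊕ Fin n}
    (hf : IsGraphCopy G f) : IsGraphCopy G (Sum.swap ∘ f) := by
  refine ⟨Sum.swap_leftInverse.injective.comp hf.1, fun a b hab => ?_⟩
  have := hf.2 a b hab
  simp only [Function.comp_apply]
  generalize f a = x at this ⊢
  generalize f b = y at this ⊢
  rcases x with v | v <;> rcases y with w | w <;> simp_all [crossB]

theorem graphRedCount_swap {n : ℕ} {γ : Type*} (c : Fin n → Fin n → Bool) (G : SimpleGraph γ)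
    (f : γ → Fin n ⊕ Fin n) :
    graphRedCount c G (Sum.swap ∘ f) = graphRedCount (fun w v => c v w) G f := by
  rw [graphRedCount, graphRedCount]
  congr 1
  ext e
  induction e with | _ a b =>
  simp only [Set.mem_sep_iff, redSym, Sym2.map_mk, Sym2.lift_mk, Function.comp_apply]
  rcases f a with v | v <;> rcases f b with w | w <;> simp [redB]

/-- A split pattern contains a copy of any tree in which half of the edges, rounded down, are
red. -/
theorem HasSplitPattern.exists_isGraphCopy {n : ℕ} {γ : Type*} [Fintype γ] {T : SimpleGraph γ}
    (hT : T.IsTree) {c : Fin n → Fin n → Bool} (hc : HasSplitPattern (Fintype.card γ) c) :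
    ∃ f : γ → Fin n ⊕ Fin n, IsGraphCopy T f ∧ graphRedCount c T f = T.edgeSet.ncard / 2 := by
  classical
  obtain ⟨X, Y, Z, hXY, hcompl, hZY, hZ⟩ := hT.exists_isBipartiteWith_sum_degree_eq_half
  obtain ⟨P, Q, S, hP, hQ, hS, hPS, hQS⟩ := hc
  have hinj : ∀ U : Finset (Fin n), Fintype.card γ ≤ U.card →
      ∃ g : γ → Fin n, Function.Injective g ∧ ∀ x, g x ∈ U := by
    intro U hU
    obtain ⟨g⟩ := Function.Embedding.nonempty_of_card_le (α := γ) (β := U) (by simpa using hU)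
    exact ⟨fun x => g x, Subtype.val_injective.comp g.injective, fun x => (g x).2⟩
  obtain ⟨p, hp, hpP⟩ := hinj P hP
  obtain ⟨q, hq, hqQ⟩ := hinj Q hQ
  obtain ⟨s, hs, hsS⟩ := hinj S hS
  have hps : ∀ x y, c (p x) (s y) = true := fun x y => hPS _ (hpP x) _ (hsS y)
  have hqs : ∀ x y, c (q x) (s y) = false := fun x y => hQS _ (hqQ x) _ (hsS y)
  have hpq : ∀ x y, p x ≠ q y := fun x y h => by
    have := hps x x
    rw [h, hqs] at this
    cases this
  have hX : ∀ v ∈ X, v ∉ Y := fun v hv hvY => Set.disjoint_left.1 hXY.disjoint hv hvY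
  have hadj : ∀ v w, T.Adj v w → v ∈ X ∧ w ∈ Y ∨ v ∈ Y ∧ w ∈ X := fun v w h => hXY.mem_of_adj h
  set f : γ → Fin n ⊕ Fin n :=
    fun v => if v ∈ Z then .inl (p v) else if v ∈ Y then .inl (q v) else .inr (s v) with hf
  have hcopy : IsGraphCopy T f := by
    refine ⟨fun v w hvw => ?_, fun v w hvw => ?_⟩
    · simp only [hf] at hvw
      split_ifs at hvw <;> simp_all [hp.eq_iff, hq.eq_iff, hs.eq_iff]
      exact absurd hvw.symm (hpq _ _)
    · have := hadj v w hvw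
      simp only [hf]
      split_ifs <;> simp [crossB] <;> grind
  refine ⟨f, hcopy, ?_⟩
  have hred : {e ∈ T.edgeSet | redSym c (Sym2.map f e) = true} =
      {e ∈ T.edgeSet | ∃ v ∈ Z, v ∈ e} := by
    ext e
    induction e with | _ a b =>
    simp only [Set.mem_sep_iff, redSym, Sym2.map_mk, Sym2.lift_mk, SimpleGraph.mem_edgeSet,
      Sym2.mem_iff, and_congr_right_iff]
    intro hab
    have := hadj a b hab
    simp only [hf]
    split_ifs <;> simp [redB, hps, hqs] <;> grind
  rw [graphRedCount, hred, T.ncard_edges_meeting_independent, hZ, ← SimpleGraph.coe_edgeFinset,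
    Set.ncard_coe_finset]
  intro u hu v hv _ huv
  have := hadj u v huv
  have := hZY hu
  have := hZY hv
  grind

/-- Every tree is bipartite balanceable.  Let `T` be a tree with `m` edges.  There is `N`
such that for every `n ≥ N` there is an integer `z < n²/2` such that every 2-edge coloring
of `K_{n,n}` with more than `z` edges in each color class contains a balanced copy of `T`:
a copy whose edge set splits into red edges `E₁` and blue edges `E₂` with
`||E₁| - |E₂|| ≤ 1`. -/
theorem trees_bipartite_balanceable {γ : Type*} [Fintype γ] (T : SimpleGraph γ)
    (hT : T.IsTree) (m : ℕ) (hm : T.edgeSet.ncard = m) :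
    ∃ N : ℕ, 0 < N ∧ ∀ n : ℕ, N ≤ n → ∃ z : ℕ, 2 * z < n ^ 2 ∧
      ∀ c : Fin n → Fin n → Bool, z < redTotal c → z < blueTotal c →
        ∃ f : γ → Fin n ⊕ Fin n, IsGraphCopy T f ∧
          graphRedCount c T f + graphBlueCount c T f = m ∧
          graphRedCount c T f ≤ graphBlueCount c T f + 1 ∧
          graphBlueCount c T f ≤ graphRedCount c T f + 1 := by
  classical
  obtain ⟨v₀⟩ := hT.connected.nonempty
  have hk : 0 < Fintype.card γ := Fintype.card_pos_iff.2 ⟨v₀⟩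
  set k := Fintype.card γ
  refine ⟨16 * k * k + 8 * (k + (16 * k) ^ k * ((16 * k) ^ k * k)), by positivity,
    fun n hn => ⟨n ^ 2 / 4, ?_, fun c hred hblue => ?_⟩⟩
  · have : 0 < n := lt_of_lt_of_le (by positivity) hn
    have : 0 < n ^ 2 := by positivity
    omega
  obtain ⟨f, hf, hcount⟩ : ∃ f : γ → Fin n ⊕ Fin n, IsGraphCopy T f ∧
      graphRedCount c T f = T.edgeSet.ncard / 2 := by
    rcases hasSplitPattern_or_of_quarter hk hn c (by omega) (by omega) with h | h
    · exact h.exists_isGraphCopy hT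
    · obtain ⟨f, hf, hcount⟩ := h.exists_isGraphCopy hT
      exact ⟨Sum.swap ∘ f, hf.swap, by rw [graphRedCount_swap, hcount]⟩
  have hadd := graphRedCount_add_graphBlueCount c T hf
  exact ⟨f, hf, by omega, by omega, by omega⟩
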